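/- Let P_DC^N be the restriction to the total N-photon subspace (N ≥ 1) of the double-click POVM P_DC = p_z P_{H/V} + (1−p_z) P_{D/A}, where P_{H/V}^N = Π^N − |0,N⟩⟨0,N|_{H/V} − |N,0⟩⟨N,0|_{H/V} and similarly for D/A. Then the smallest eigenvalue of P_DC^N equals 1/2 − (1/2)√((2p_z−1)² + 8·2^{−N} p_z(1−p_z)) if N is odd, and 1/2 − (1/2)√((2p_z−1)² + 16·2^{−N} p_z(1−p_z)) if N is even. -/

import Mathlib

open Matrix Complex

/-- Outer product `|v⟩⟨v|`. -/
noncomputable def outer {n : Type*} (v : n → ℂ) : Matrix n n ℂ :=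
  Matrix.vecMulVec v (star v)

/-- The vector `|N,0⟩_{D/A} = 2^{-N/2} Σ_k √(C(N,k)) |k, N−k⟩_{H/V}` in the `N`-photon
subspace (coordinates w.r.t. the basis `{|k, N−k⟩_{H/V}}_{k=0}^{N}`). -/
noncomputable def uDA (N : ℕ) : Fin (N + 1) → ℂ := fun k =>
  (((2 : ℝ) ^ (-(N : ℝ) / 2) * Real.sqrt (N.choose k) : ℝ) : ℂ)

/-- The vector `|0,N⟩_{D/A} = 2^{-N/2} Σ_k (−1)^{N−k} √(C(N,k)) |k, N−k⟩_{H/V}`. -/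
noncomputable def vDA (N : ℕ) : Fin (N + 1) → ℂ := fun k =>
  ((-1 : ℂ)) ^ (N - (k : ℕ)) *
    (((2 : ℝ) ^ (-(N : ℝ) / 2) * Real.sqrt (N.choose k) : ℝ) : ℂ)

/-- The `N`-photon block of the double-click POVM
`P_DC = p_z P_{H/V} + (1 − p_z) P_{D/A}`, where
`P_{H/V}^N = Π^N − |0,N⟩⟨0,N|_{H/V} − |N,0⟩⟨N,0|_{H/V}` and similarly for `D/A`. -/
noncomputable def PDCblock (N : ℕ) (p : ℝ) :
    Matrix (Fin (N + 1)) (Fin (N + 1)) ℂ :=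
  (p : ℂ) • ((1 : Matrix (Fin (N + 1)) (Fin (N + 1)) ℂ)
      - outer (fun j : Fin (N + 1) => if (j : ℕ) = 0 then 1 else 0)
      - outer (fun j : Fin (N + 1) => if (j : ℕ) = N then 1 else 0))
  + ((1 - p : ℝ) : ℂ) • ((1 : Matrix (Fin (N + 1)) (Fin (N + 1)) ℂ)
      - outer (uDA N) - outer (vDA N))

/-- Action of an outer product on a vector. -/
lemma outer_mulVec {n : Type*} [Fintype n] (v w : n → ℂ) :
    outer v *ᵥ w = (star v ⬝ᵥ w) • v := by
  rw [outer, vecMulVec_mulVec]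
  ext i
  simp [mul_comm]

/-- The amplitude `2^{-N/2}` of the extreme coordinates of `uDA` and `vDA`. -/
noncomputable def ampDA (N : ℕ) : ℝ := (2 : ℝ) ^ (-(N : ℝ) / 2)

lemma ampDA_pos (N : ℕ) : 0 < ampDA N := Real.rpow_pos_of_pos two_pos _

lemma ampDA_sq (N : ℕ) : ampDA N ^ 2 = (2 : ℝ) ^ (-(N : ℝ)) := by
  rw [ampDA, ← Real.rpow_natCast, ← Real.rpow_mul two_pos.le]
  norm_num

lemma ampDA_sq_mul (N : ℕ) : ampDA N ^ 2 * 2 ^ N = 1 := by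
  rw [ampDA_sq, Real.rpow_neg two_pos.le, Real.rpow_natCast]
  exact inv_mul_cancel₀ (by positivity)

lemma uDA_apply (N : ℕ) (k : Fin (N + 1)) :
    uDA N k = (ampDA N : ℂ) * (Real.sqrt (N.choose k) : ℝ) := by
  simp only [uDA, ampDA, ofReal_mul]

lemma vDA_apply (N : ℕ) (k : Fin (N + 1)) :
    vDA N k = (-1) ^ (N - (k : ℕ)) * uDA N k := rfl

lemma star_uDA (N : ℕ) : star (uDA N) = uDA N := by
  ext k
  simp [uDA_apply]

lemma star_vDA (N : ℕ) : star (vDA N) = vDA N := by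
  ext k
  simp [vDA_apply, uDA_apply]

lemma uDA_zero (N : ℕ) : uDA N 0 = ampDA N := by simp [uDA_apply]

lemma uDA_last (N : ℕ) : uDA N (Fin.last N) = ampDA N := by simp [uDA_apply]

lemma vDA_zero (N : ℕ) : vDA N 0 = (-1) ^ N * ampDA N := by simp [vDA_apply, uDA_zero]

lemma vDA_last (N : ℕ) : vDA N (Fin.last N) = ampDA N := by simp [vDA_apply, uDA_last]

lemma uDA_mul_self (N : ℕ) (k : Fin (N + 1)) :
    uDA N k * uDA N k = (ampDA N : ℂ) ^ 2 * (N.choose k : ℂ) := by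
  have h : ((Real.sqrt (N.choose k) : ℝ) : ℂ) * (Real.sqrt (N.choose k) : ℝ)
      = (N.choose k : ℂ) := by
    rw [← ofReal_mul, Real.mul_self_sqrt (Nat.cast_nonneg _), ofReal_natCast]
  rw [uDA_apply, ← h]
  ring

lemma uDA_dotProduct_self (N : ℕ) : uDA N ⬝ᵥ uDA N = 1 := by
  simp only [dotProduct, uDA_mul_self]
  rw [← Finset.mul_sum, Fin.sum_univ_eq_sum_range (fun k => (N.choose k : ℂ)),
    ← Nat.cast_sum, Nat.sum_range_choose]
  exact_mod_cast ampDA_sq_mul N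

lemma vDA_dotProduct_self (N : ℕ) : vDA N ⬝ᵥ vDA N = 1 := by
  rw [← uDA_dotProduct_self N]
  refine Finset.sum_congr rfl fun k _ => ?_
  rw [vDA_apply, mul_mul_mul_comm, ← mul_pow]
  simp

lemma uDA_dotProduct_vDA {N : ℕ} (hN : 1 ≤ N) : uDA N ⬝ᵥ vDA N = 0 := by
  have h : ∀ k : Fin (N + 1), uDA N k * vDA N k
      = (ampDA N : ℂ) ^ 2 * (1 ^ (k : ℕ) * (-1) ^ (N - (k : ℕ)) * (N.choose k : ℂ)) := by
    intro k
    rw [vDA_apply, mul_left_comm, uDA_mul_self]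
    ring
  simp only [dotProduct, h]
  rw [← Finset.mul_sum,
    Fin.sum_univ_eq_sum_range (fun k => (1 : ℂ) ^ k * (-1) ^ (N - k) * (N.choose k : ℂ)),
    ← add_pow, add_neg_cancel, zero_pow (by omega), mul_zero]

/-- Action of the double-click block on a vector. -/
lemma PDCblock_mulVec (N : ℕ) (p : ℝ) (w : Fin (N + 1) → ℂ) :
    PDCblock N p *ᵥ w = w
      - (p : ℂ) • (w 0 • Pi.single 0 1 + w (Fin.last N) • Pi.single (Fin.last N) 1)
      - (1 - p : ℂ) • ((uDA N ⬝ᵥ w) • uDA N + (vDA N ⬝ᵥ w) • vDA N) := by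
  have h0 : (fun j : Fin (N + 1) => if (j : ℕ) = 0 then (1 : ℂ) else 0) = Pi.single 0 1 := by
    ext j
    simp [Pi.single_apply]
  have hl : (fun j : Fin (N + 1) => if (j : ℕ) = N then (1 : ℂ) else 0)
      = Pi.single (Fin.last N) 1 := by
    ext j
    rw [Pi.single_apply]
    exact if_congr (by rw [Fin.ext_iff, Fin.val_last]) rfl rfl
  have hs : ∀ i : Fin (N + 1), star (Pi.single i 1 : Fin (N + 1) → ℂ) = Pi.single i 1 := by
    intro i
    rw [← Pi.single_star, star_one]
  rw [PDCblock, h0, hl]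
  simp only [add_mulVec, smul_mulVec, sub_mulVec, one_mulVec, outer_mulVec, star_uDA, star_vDA,
    hs, single_one_dotProduct, ofReal_sub, ofReal_one]
  module

/-- The square of the largest overlap between the ranges of the two click projectors. -/
noncomputable def overlapSq (N : ℕ) : ℝ := (if Odd N then 2 else 4) * ampDA N ^ 2

/-- The largest eigenvalue of the no-double-click operator. -/
noncomputable def topEigenvalue (N : ℕ) (p : ℝ) : ℝ :=
  1 / 2 + Real.sqrt ((2 * p - 1) ^ 2 + 4 * overlapSq N * p * (1 - p)) / 2

section Top

variable {N : ℕ} {p : ℝ}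

lemma overlapSq_pos (N : ℕ) : 0 < overlapSq N := by
  have := ampDA_pos N
  unfold overlapSq
  split_ifs <;> positivity

lemma discr_nonneg (N : ℕ) (hp : p ∈ Set.Icc (0 : ℝ) 1) :
    0 ≤ 4 * overlapSq N * p * (1 - p) :=
  mul_nonneg (mul_nonneg (mul_nonneg (by norm_num) (overlapSq_pos N).le) hp.1)
    (sub_nonneg.2 hp.2)

lemma topEigenvalue_eq (N : ℕ) (hp : p ∈ Set.Icc (0 : ℝ) 1) :
    (topEigenvalue N p - p) * (topEigenvalue N p - (1 - p)) = overlapSq N * p * (1 - p) := by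
  have h := Real.sq_sqrt (add_nonneg (sq_nonneg (2 * p - 1)) (discr_nonneg N hp))
  unfold topEigenvalue
  linear_combination h / 4

lemma abs_le_topEigenvalue (N : ℕ) (hp : p ∈ Set.Icc (0 : ℝ) 1) :
    1 / 2 + |2 * p - 1| / 2 ≤ topEigenvalue N p := by
  have h := Real.abs_le_sqrt (le_add_of_nonneg_right (a := (2 * p - 1) ^ 2) (discr_nonneg N hp))
  unfold topEigenvalue
  linarith

lemma topEigenvalue_pos (N : ℕ) (hp : p ∈ Set.Icc (0 : ℝ) 1) : 0 < topEigenvalue N p := by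
  linarith [abs_le_topEigenvalue N hp, abs_nonneg (2 * p - 1)]

lemma le_topEigenvalue (N : ℕ) (hp : p ∈ Set.Icc (0 : ℝ) 1) : p ≤ topEigenvalue N p := by
  linarith [abs_le_topEigenvalue N hp, le_abs_self (2 * p - 1)]

lemma one_sub_le_topEigenvalue (N : ℕ) (hp : p ∈ Set.Icc (0 : ℝ) 1) :
    1 - p ≤ topEigenvalue N p := by
  linarith [abs_le_topEigenvalue N hp, neg_abs_le (2 * p - 1)]

/-- The smallest eigenvalue is attained. -/
lemma exists_eigenvector (hN : 1 ≤ N) (hp : p ∈ Set.Icc (0 : ℝ) 1) :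
    ∃ w : Fin (N + 1) → ℂ, w ≠ 0 ∧
      PDCblock N p *ᵥ w = ((1 - topEigenvalue N p : ℝ) : ℂ) • w := by
  have hne : (0 : Fin (N + 1)) ≠ Fin.last N := by
    rw [Ne, Fin.ext_iff]
    simp
    omega
  have hvu : vDA N ⬝ᵥ uDA N = 0 := by rw [dotProduct_comm, uDA_dotProduct_vDA hN]
  have hs : (ampDA N : ℂ) ≠ 0 := by exact_mod_cast (ampDA_pos N).ne'
  have ht : (topEigenvalue N p : ℂ) ≠ 0 := by exact_mod_cast (topEigenvalue_pos N hp).ne'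
  have hq : ((topEigenvalue N p : ℂ) - p) * (topEigenvalue N p - (1 - p))
      = overlapSq N * p * (1 - p) := by exact_mod_cast topEigenvalue_eq N hp
  have hst : (2 * ampDA N * topEigenvalue N p : ℂ) ≠ 0 := by simp [hs, ht]
  rcases Nat.even_or_odd N with hpar | hpar
  · have hc : (overlapSq N : ℂ) = 4 * ampDA N ^ 2 := by
      simp [overlapSq, Nat.not_odd_iff_even.2 hpar]
    rw [hc] at hq
    set w : Fin (N + 1) → ℂ :=
      (2 * p * ampDA N : ℂ) • (Pi.single 0 1 + Pi.single (Fin.last N) 1)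
        + (topEigenvalue N p - p : ℂ) • (uDA N + vDA N) with hw
    have h0 : w 0 = 2 * ampDA N * topEigenvalue N p := by
      simp [hw, uDA_zero, vDA_zero, hpar.neg_one_pow, hne]
      ring
    have hl : w (Fin.last N) = 2 * ampDA N * topEigenvalue N p := by
      simp [hw, uDA_last, vDA_last, hne.symm]
      ring
    have hu : uDA N ⬝ᵥ w = 4 * p * ampDA N ^ 2 + (topEigenvalue N p - p) := by
      simp [hw, dotProduct_add, uDA_zero, uDA_last, uDA_dotProduct_self, uDA_dotProduct_vDA hN]
      ring
    have hv : vDA N ⬝ᵥ w = 4 * p * ampDA N ^ 2 + (topEigenvalue N p - p) := by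
      simp [hw, dotProduct_add, vDA_zero, vDA_last, vDA_dotProduct_self, hvu, hpar.neg_one_pow]
      ring
    refine ⟨w, fun h => hst (by rw [← h0, h]; rfl), ?_⟩
    rw [PDCblock_mulVec, h0, hl, hu, hv]
    ext i
    simp [hw]
    linear_combination (uDA N i + vDA N i) * hq
  · have hc : (overlapSq N : ℂ) = 2 * ampDA N ^ 2 := by
      simp [overlapSq, hpar]
    rw [hc] at hq
    set w : Fin (N + 1) → ℂ :=
      (2 * p * ampDA N : ℂ) • Pi.single 0 1
        + (topEigenvalue N p - p : ℂ) • (uDA N - vDA N) with hw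
    have h0 : w 0 = 2 * ampDA N * topEigenvalue N p := by
      simp [hw, uDA_zero, vDA_zero, hpar.neg_one_pow]
      ring
    have hl : w (Fin.last N) = 0 := by
      simp [hw, uDA_last, vDA_last, hne.symm]
    have hu : uDA N ⬝ᵥ w = 2 * p * ampDA N ^ 2 + (topEigenvalue N p - p) := by
      simp [hw, dotProduct_add, dotProduct_sub, uDA_zero, uDA_dotProduct_self,
        uDA_dotProduct_vDA hN]
      ring
    have hv : vDA N ⬝ᵥ w = -(2 * p * ampDA N ^ 2 + (topEigenvalue N p - p)) := by
      simp [hw, dotProduct_add, dotProduct_sub, vDA_zero, vDA_dotProduct_self, hvu,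
        hpar.neg_one_pow]
      ring
    refine ⟨w, fun h => hst (by rw [← h0, h]; rfl), ?_⟩
    rw [PDCblock_mulVec, h0, hl, hu, hv]
    ext i
    simp [hw]
    linear_combination (uDA N i - vDA N i) * hq

/-- No eigenvalue of the block lies below `1 - topEigenvalue N p`. -/
lemma eigenvector_bound (hN : 1 ≤ N) (hp : p ∈ Set.Icc (0 : ℝ) 1) {μ : ℝ}
    {w : Fin (N + 1) → ℂ} (hw : w ≠ 0) (h : PDCblock N p *ᵥ w = ((1 - μ : ℝ) : ℂ) • w) :
    μ ≤ topEigenvalue N p := by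
  by_contra! hlt
  apply hw
  have hne : (0 : Fin (N + 1)) ≠ Fin.last N := by
    rw [Ne, Fin.ext_iff]
    simp
    omega
  have hvu : vDA N ⬝ᵥ uDA N = 0 := by rw [dotProduct_comm, uDA_dotProduct_vDA hN]
  have hpμ : p < μ := (le_topEigenvalue N hp).trans_lt hlt
  have hqμ : 1 - p < μ := (one_sub_le_topEigenvalue N hp).trans_lt hlt
  have hμ : (μ : ℂ) ≠ 0 := by exact_mod_cast (hp.1.trans_lt hpμ).ne'
  have hp' : (μ - p : ℂ) ≠ 0 := by exact_mod_cast (sub_pos.2 hpμ).ne'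
  have hq' : (μ - (1 - p) : ℂ) ≠ 0 := by exact_mod_cast (sub_pos.2 hqμ).ne'
  have hdet : ((μ - p) * (μ - (1 - p)) - overlapSq N * p * (1 - p) : ℂ) ≠ 0 := by
    have : overlapSq N * p * (1 - p) < (μ - p) * (μ - (1 - p)) := by
      rw [← topEigenvalue_eq N hp]
      nlinarith [le_topEigenvalue N hp, one_sub_le_topEigenvalue N hp]
    exact_mod_cast (sub_pos.2 this).ne'
  have key : (μ : ℂ) • w
      = (p : ℂ) • (w 0 • Pi.single 0 1 + w (Fin.last N) • Pi.single (Fin.last N) 1)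
        + (1 - p : ℂ) • ((uDA N ⬝ᵥ w) • uDA N + (vDA N ⬝ᵥ w) • vDA N) := by
    rw [PDCblock_mulVec, ofReal_sub, ofReal_one] at h
    linear_combination (norm := module) h
  have e0 := congrFun key 0
  have el := congrFun key (Fin.last N)
  have eu := congrArg (uDA N ⬝ᵥ ·) key
  have ev := congrArg (vDA N ⬝ᵥ ·) key
  simp [uDA_zero, vDA_zero, hne] at e0
  simp [uDA_last, vDA_last, hne.symm] at el
  simp [dotProduct_add, uDA_zero, uDA_last, uDA_dotProduct_self, uDA_dotProduct_vDA hN] at eu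
  simp [dotProduct_add, vDA_zero, vDA_last, vDA_dotProduct_self, hvu] at ev
  have hends : w 0 = 0 ∧ w (Fin.last N) = 0 := by
    rcases Nat.even_or_odd N with hpar | hpar
    · have hc : (overlapSq N : ℂ) = 4 * ampDA N ^ 2 := by
        simp [overlapSq, Nat.not_odd_iff_even.2 hpar]
      rw [hc] at hdet
      simp only [hpar.neg_one_pow] at e0 ev
      have hsum : w 0 + w (Fin.last N) = 0 := by
        refine (mul_eq_zero.1 ?_).resolve_left hdet
        linear_combination (μ - (1 - p) : ℂ) * (e0 + el)
          + 2 * (1 - p) * ampDA N * (eu + ev)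
      have hdiff : w 0 - w (Fin.last N) = 0 := by
        refine (mul_eq_zero.1 ?_).resolve_left hp'
        linear_combination e0 - el
      constructor
      · linear_combination (hsum + hdiff) / 2
      · linear_combination (hsum - hdiff) / 2
    · have hc : (overlapSq N : ℂ) = 2 * ampDA N ^ 2 := by
        simp [overlapSq, hpar]
      rw [hc] at hdet
      simp only [hpar.neg_one_pow] at e0 ev
      constructor
      · refine (mul_eq_zero.1 ?_).resolve_left hdet
        linear_combination (μ - (1 - p) : ℂ) * e0 + (1 - p) * ampDA N * (eu - ev)
      · refine (mul_eq_zero.1 ?_).resolve_left hdet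
        linear_combination (μ - (1 - p) : ℂ) * el + (1 - p) * ampDA N * (eu + ev)
  rw [hends.1, hends.2] at eu ev key
  have hu : uDA N ⬝ᵥ w = 0 := by
    refine (mul_eq_zero.1 ?_).resolve_left hq'
    linear_combination eu
  have hv : vDA N ⬝ᵥ w = 0 := by
    refine (mul_eq_zero.1 ?_).resolve_left hq'
    linear_combination ev
  rw [hu, hv] at key
  simpa [ofReal_ne_zero.1 hμ] using key

end Top

/-- The smallest eigenvalue of the `N`-photon block (`N ≥ 1`) of the
double-click POVM `P_DC = p_z P_{H/V} + (1−p_z) P_{D/A}` equals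
`1/2 − (1/2)√((2p_z−1)² + 8·2^{−N} p_z(1−p_z))` if `N` is odd, and
`1/2 − (1/2)√((2p_z−1)² + 16·2^{−N} p_z(1−p_z))` if `N` is even. -/
theorem stmt7 (N : ℕ) (hN : 1 ≤ N) (p : ℝ) (hp : p ∈ Set.Icc (0 : ℝ) 1)
    (h : (PDCblock N p).IsHermitian) :
    IsLeast (Set.range h.eigenvalues)
      (if Odd N then
        1 / 2 - Real.sqrt ((2 * p - 1) ^ 2 + 8 * (2 : ℝ) ^ (-(N : ℝ)) * p * (1 - p)) / 2
      else
        1 / 2 - Real.sqrt ((2 * p - 1) ^ 2 + 16 * (2 : ℝ) ^ (-(N : ℝ)) * p * (1 - p)) / 2) := by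
  have hval : (if Odd N then
        1 / 2 - Real.sqrt ((2 * p - 1) ^ 2 + 8 * (2 : ℝ) ^ (-(N : ℝ)) * p * (1 - p)) / 2
      else
        1 / 2 - Real.sqrt ((2 * p - 1) ^ 2 + 16 * (2 : ℝ) ^ (-(N : ℝ)) * p * (1 - p)) / 2)
      = 1 - topEigenvalue N p := by
    rw [topEigenvalue, overlapSq, ampDA_sq]
    split_ifs <;> ring_nf
  rw [hval]
  constructor
  · obtain ⟨w, hw, hwe⟩ := exists_eigenvector hN hp
    have hev : Module.End.HasEigenvalue (Matrix.toLin' (PDCblock N p))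
        ((1 - topEigenvalue N p : ℝ) : ℂ) :=
      Module.End.hasEigenvalue_of_hasEigenvector
        ⟨Module.End.mem_eigenspace_iff.2 (by rwa [Matrix.toLin'_apply]), hw⟩
    have hmem := hev.mem_spectrum
    rw [Matrix.spectrum_toLin', h.spectrum_eq_image_range] at hmem
    obtain ⟨x, hx, hxe⟩ := hmem
    exact ofReal_injective hxe ▸ hx
  · rintro _ ⟨i, rfl⟩
    have hne : (h.eigenvectorBasis i).ofLp ≠ 0 := by
      simpa using h.eigenvectorBasis.orthonormal.ne_zero i
    have hbound := eigenvector_bound (μ := 1 - h.eigenvalues i) hN hp hne (by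
      rw [sub_sub_cancel, h.mulVec_eigenvectorBasis]
      ext j
      simp)
    linarith
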